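/- Let Y ∈ ℳ_p with rank(Y) < p, and assume A_1 Y, …, A_m Y are linearly independent. If Y is a second-order critical point, i.e., S(Y) Y = 0 and ⟨Ẏ, S(Y) Ẏ⟩ ≥ 0 for every Ẏ ∈ ℝ^{n×p} with ⟨A_i Y, Ẏ⟩ = 0 for all i, then S(Y) is positive semidefinite; consequently Y is globally optimal for the factorized problem (⟨C Y, Y⟩ ≤ ⟨C Y', Y'⟩ for all Y' ∈ ℳ_p) and X = YYᵀ is globally optimal for the SDP (⟨C, X⟩ ≤ ⟨C, X'⟩ for all X' ∈ 𝒞). -/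

import Mathlib

open Matrix MeasureTheory

noncomputable section

/-- Frobenius inner product ⟨A,B⟩ = trace(AᵀB). -/
def ip {n p : ℕ} (A B : Matrix (Fin n) (Fin p) ℝ) : ℝ := Matrix.trace (Aᵀ * B)

/-- The constraint map 𝒜(X)ᵢ = trace(Aᵢ X). -/
def calA {n m : ℕ} (A : Fin m → Matrix (Fin n) (Fin n) ℝ) (X : Matrix (Fin n) (Fin n) ℝ) :
    Fin m → ℝ := fun i => Matrix.trace (A i * X)

/-- The adjoint 𝒜*(ν) = ∑ νᵢ Aᵢ. -/
def adjA {n m : ℕ} (A : Fin m → Matrix (Fin n) (Fin n) ℝ) (ν : Fin m → ℝ) :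
    Matrix (Fin n) (Fin n) ℝ := ∑ i, ν i • A i

/-- ℳ_p = {Y ∈ ℝ^{n×p} : 𝒜(YYᵀ) = b}. -/
def MM {n m : ℕ} (A : Fin m → Matrix (Fin n) (Fin n) ℝ) (b : Fin m → ℝ) (p : ℕ) :
    Set (Matrix (Fin n) (Fin p) ℝ) := {Y | calA A (Y * Yᵀ) = b}

/-- 𝒞 = {X ∈ Sym(n,ℝ) : 𝒜(X) = b, X ⪰ 0}. -/
def CC {n m : ℕ} (A : Fin m → Matrix (Fin n) (Fin n) ℝ) (b : Fin m → ℝ) :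
    Set (Matrix (Fin n) (Fin n) ℝ) := {X | X.IsSymm ∧ calA A X = b ∧ X.PosSemidef}

/-- Gram matrix G(Y)ᵢⱼ = ⟨AᵢY, AⱼY⟩. -/
def gram {n m p : ℕ} (A : Fin m → Matrix (Fin n) (Fin n) ℝ) (Y : Matrix (Fin n) (Fin p) ℝ) :
    Matrix (Fin m) (Fin m) ℝ := Matrix.of fun i j => ip (A i * Y) (A j * Y)

/-- S(Y) = C − 𝒜*(G(Y)⁻¹ 𝒜(C Y Yᵀ)). -/
def Smat {n m p : ℕ} (A : Fin m → Matrix (Fin n) (Fin n) ℝ) (C : Matrix (Fin n) (Fin n) ℝ)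
    (Y : Matrix (Fin n) (Fin p) ℝ) : Matrix (Fin n) (Fin n) ℝ :=
  C - adjA A ((gram A Y)⁻¹ *ᵥ calA A (C * (Y * Yᵀ)))

/-- Frobenius norm. -/
def frob {a c : ℕ} (M : Matrix (Fin a) (Fin c) ℝ) : ℝ := Real.sqrt (∑ i, ∑ j, (M i j) ^ 2)


theorem Matrix.exists_mulVec_eq_zero_of_rank_lt {K : Type*} [Field K] {n p : ℕ}
    (Y : Matrix (Fin n) (Fin p) K) (h : Y.rank < p) : ∃ z, z ≠ 0 ∧ Y *ᵥ z = 0 := by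
  have hker : Y.mulVecLin.ker ≠ ⊥ := by
    intro hbot
    have := Y.mulVecLin.finrank_range_add_finrank_ker
    rw [hbot, finrank_bot, Module.finrank_fin_fun] at this
    exact h.ne this
  obtain ⟨z, hz, hz0⟩ := Submodule.exists_mem_ne_zero_of_ne_bot hker
  exact ⟨z, hz0, by simpa using hz⟩

theorem ip_vecMulVec {n p : ℕ} (B : Matrix (Fin n) (Fin p) ℝ) (x : Fin n → ℝ) (z : Fin p → ℝ) :
    ip B (vecMulVec x z) = x ⬝ᵥ B *ᵥ z := by
  rw [ip, mul_vecMulVec, trace_vecMulVec, mulVec_transpose, dotProduct_mulVec]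

theorem Matrix.PosSemidef.trace_mul_nonneg {n : ℕ} {S X : Matrix (Fin n) (Fin n) ℝ}
    (hS : S.PosSemidef) (hX : X.PosSemidef) : 0 ≤ trace (S * X) := by
  obtain ⟨k, v, rfl⟩ := posSemidef_iff_eq_sum_vecMulVec.mp hX
  rw [Finset.mul_sum, trace_sum]
  refine Finset.sum_nonneg fun i _ => ?_
  rw [mul_vecMulVec, trace_vecMulVec, dotProduct_comm]
  exact hS.dotProduct_mulVec_nonneg _

theorem adjA_isSymm {n m : ℕ} {A : Fin m → Matrix (Fin n) (Fin n) ℝ} (hA : ∀ i, (A i).IsSymm)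
    (ν : Fin m → ℝ) : (adjA A ν).IsSymm := by
  simp only [Matrix.IsSymm, adjA, transpose_sum, transpose_smul, (hA _).eq]

theorem trace_adjA_mul {n m : ℕ} (A : Fin m → Matrix (Fin n) (Fin n) ℝ) (ν : Fin m → ℝ)
    (X : Matrix (Fin n) (Fin n) ℝ) : trace (adjA A ν * X) = ν ⬝ᵥ calA A X := by
  simp [adjA, calA, Finset.sum_mul, trace_sum, dotProduct]

theorem ip_mul_self {n p : ℕ} (C : Matrix (Fin n) (Fin n) ℝ) (Y : Matrix (Fin n) (Fin p) ℝ) :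
    ip (C * Y) Y = trace (Cᵀ * (Y * Yᵀ)) := by
  rw [ip, transpose_mul, Matrix.mul_assoc, trace_mul_comm, Matrix.mul_assoc]

/-- A symmetric form which is nonnegative on the tangent space at a rank-deficient point
is positive semidefinite. -/
theorem posSemidef_of_rank_lt {n m p : ℕ} {A : Fin m → Matrix (Fin n) (Fin n) ℝ}
    {S : Matrix (Fin n) (Fin n) ℝ} (hS : S.IsSymm) {Y : Matrix (Fin n) (Fin p) ℝ}
    (hrk : Y.rank < p)
    (hsoc : ∀ V : Matrix (Fin n) (Fin p) ℝ, (∀ i, ip (A i * Y) V = 0) → 0 ≤ ip V (S * V)) :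
    S.PosSemidef := by
  obtain ⟨z, hz0, hz⟩ := Y.exists_mulVec_eq_zero_of_rank_lt hrk
  have hherm : S.IsHermitian := (conjTranspose_eq_transpose_of_trivial S).trans hS
  refine .of_dotProduct_mulVec_nonneg hherm fun x => ?_
  have h := hsoc (vecMulVec x z) fun i => by
    rw [ip_vecMulVec, ← mulVec_mulVec, hz, mulVec_zero, dotProduct_zero]
  rw [mul_vecMulVec, ip_vecMulVec, vecMulVec_mulVec, dotProduct_comm] at h
  have hzz : 0 < z ⬝ᵥ z := by simpa using dotProduct_star_self_pos_iff.mpr hz0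
  have h' : 0 ≤ (x ⬝ᵥ S *ᵥ x) * (z ⬝ᵥ z) := by simpa [mul_comm] using h
  simpa using nonneg_of_mul_nonneg_left h' hzz

/-- Proposition 8 of the paper: a rank-deficient second-order critical
point Y has S(Y) ⪰ 0, hence is globally optimal and X = YYᵀ is optimal for the SDP. -/
theorem stmt7 (n m p : ℕ) (hn : 1 ≤ n) (hm : 1 ≤ m) (hp : 1 ≤ p)
    (A : Fin m → Matrix (Fin n) (Fin n) ℝ) (hA : ∀ i, (A i).IsSymm)
    (C : Matrix (Fin n) (Fin n) ℝ) (hC : C.IsSymm) (b : Fin m → ℝ)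
    (Y : Matrix (Fin n) (Fin p) ℝ) (hY : Y ∈ MM A b p) (hrk : Y.rank < p)
    (hli : LinearIndependent ℝ (fun i => A i * Y))
    (hcrit : Smat A C Y * Y = 0)
    (hsoc : ∀ V : Matrix (Fin n) (Fin p) ℝ, (∀ i, ip (A i * Y) V = 0) →
      0 ≤ ip V (Smat A C Y * V)) :
    (Smat A C Y).PosSemidef ∧
    (∀ Y' ∈ MM A b p, ip (C * Y) Y ≤ ip (C * Y') Y') ∧
    (∀ X' ∈ CC A b, Matrix.trace (Cᵀ * (Y * Yᵀ)) ≤ Matrix.trace (Cᵀ * X')) := by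
  have hsymm : (Smat A C Y).IsSymm := hC.sub (adjA_isSymm hA _)
  have hpsd : (Smat A C Y).PosSemidef := posSemidef_of_rank_lt hsymm hrk hsoc
  have hsdp : ∀ X' ∈ CC A b, trace (Cᵀ * (Y * Yᵀ)) ≤ trace (Cᵀ * X') := by
    rintro X' ⟨-, hX'b, hX'⟩
    have h0 : trace (Smat A C Y * (Y * Yᵀ)) = 0 := by
      rw [← Matrix.mul_assoc, hcrit, Matrix.zero_mul, trace_zero]
    have h1 := hpsd.trace_mul_nonneg hX'
    have hYb : calA A (Y * Yᵀ) = b := hY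
    rw [Smat, Matrix.sub_mul, trace_sub, trace_adjA_mul] at h0 h1
    rw [hYb] at h0
    rw [hX'b] at h1
    rw [hC.eq]
    linarith
  refine ⟨hpsd, fun Y' hY' => ?_, hsdp⟩
  rw [ip_mul_self, ip_mul_self]
  exact hsdp _ ⟨by simp [Matrix.IsSymm], hY',
    by simpa using posSemidef_self_mul_conjTranspose Y'⟩
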